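/- arXiv:2309.07742 — 7 statements merged into one kernel-verified Lean document; each statement's English description precedes it below -/
import Mathlib

section
/- Let I and J be finite nonempty index sets, (G_i)_{i∈I} and (M_j)_{j∈J} families of finite nonempty types. Fix for each i a strictly positive pmf ν_i on G_i, and for each j a conditional pmf k_j assigning to every g ∈ ∏_{i∈I} G_i a pmf k_j(·|g) on M_j. Then the following are equivalent: (i) [condition D1 of alignment] there exists a map π : J → I such that for every j ∈ J the conditional pmf k_j depends only on the coordinate g_{π(j)}, i.e., k_j(·|g) = k_j(·|g') whenever g_{π(j)} = g'_{π(j)}; (ii) [disentanglement of the representation, i.e., vanishing EMPIDA] for every j ∈ J there exists i ∈ I such that for every a ∈ G_i and every g₋ ∈ ∏_{i'≠i} G_{i'}, the partially-intervened distribution of M_j at a equals the fully-intervened distribution at (a,g₋): ∑_{g'₋ ∈ ∏_{i'≠i} G_{i'}} (∏_{i'≠i} ν_{i'})(g'₋)·k_j(m | (a,g'₋)) = k_j(m | (a,g₋)) for all m ∈ M_j. -/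
open Finset

/-- The product of finitely many pmfs has total mass one. -/
theorem sum_prod_eq_one_of_sum_eq_one {ι : Type*} [Fintype ι] [DecidableEq ι]
    {α : ι → Type*} [∀ i, Fintype (α i)] (w : ∀ i, α i → ℝ)
    (hw : ∀ i, ∑ a, w i a = 1) : ∑ x : ∀ i, α i, ∏ i, w i (x i) = 1 := by
  rw [← Fintype.piFinset_univ, ← Finset.prod_univ_sum]
  exact Finset.prod_eq_one fun i _ => hw i

/-- A family is recovered from its `i`-th coordinate and its remaining coordinates. -/
theorem dite_cast_coord_eq_self {I : Type*} [DecidableEq I] {G : I → Type*} (i : I)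
    (g : ∀ i, G i) :
    (fun i'' => if h : i'' = i then cast (congrArg G h.symm) (g i) else g i'') = g := by
  funext x
  by_cases h : x = i
  · subst h
    simp
  · simp [h]

/-- Equivalence between condition D1 of alignment (each machine
representation depends only on a single generative factor) and disentanglement of the
representation (vanishing EMPIDA: for each `j` there is an `i` such that the
partially-intervened distribution of `M j` coincides with the fully-intervened one). -/
theorem d1_iff_disentangled
    {I J : Type*} [Fintype I] [Nonempty I] [DecidableEq I] [Fintype J] [Nonempty J]
    (G : I → Type*) [∀ i, Fintype (G i)] [∀ i, Nonempty (G i)]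
    (M : J → Type*) [∀ j, Fintype (M j)] [∀ j, Nonempty (M j)]
    (ν : ∀ i, G i → ℝ)
    (hν_pos : ∀ i (a : G i), 0 < ν i a)
    (hν_sum : ∀ i, ∑ a : G i, ν i a = 1)
    (k : ∀ j, (∀ i, G i) → M j → ℝ)
    (hk_nonneg : ∀ j g m, 0 ≤ k j g m)
    (hk_sum : ∀ j g, ∑ m : M j, k j g m = 1) :
    -- (i) condition D1: there is π : J → I such that k j depends only on coordinate π j
    (∃ π : J → I, ∀ j (g g' : ∀ i, G i), g (π j) = g' (π j) → k j g = k j g')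
    ↔
    -- (ii) disentanglement (vanishing EMPIDA): for every j there is an i such that
    -- averaging the other factors under ∏ ν equals fixing them to any value
    (∀ j, ∃ i : I,
      ∀ (a : G i) (gm : ∀ i' : {i' : I // i' ≠ i}, G i'.1) (m : M j),
        (∑ gm' : ∀ i' : {i' : I // i' ≠ i}, G i'.1,
          (∏ i' : {i' : I // i' ≠ i}, ν i'.1 (gm' i')) *
            k j (fun i'' => if h : i'' = i then cast (congrArg G h.symm) a
                            else gm' ⟨i'', h⟩) m)
        = k j (fun i'' => if h : i'' = i then cast (congrArg G h.symm) a
                          else gm ⟨i'', h⟩) m) := by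
  constructor
  · rintro ⟨π, hπ⟩ j
    refine ⟨π j, fun a gm m => ?_⟩
    have hmass := sum_prod_eq_one_of_sum_eq_one
      (fun i' : {i' : I // i' ≠ π j} => ν i'.1) (fun i' => hν_sum i'.1)
    rw [← one_mul (k j _ m), ← hmass, Finset.sum_mul]
    refine Finset.sum_congr rfl fun gm' _ => ?_
    refine congrArg _ (congrFun (hπ j _ _ ?_) m)
    simp only [dite_true]
  · intro h
    choose π hπ using h
    refine ⟨π, fun j g g' hgg' => ?_⟩
    funext m
    have h₁ := hπ j (g (π j)) (fun i' => g i'.1) m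
    have h₂ := hπ j (g (π j)) (fun i' => g' i'.1) m
    have h₃ := h₁.symm.trans h₂
    rw [dite_cast_coord_eq_self, hgg', dite_cast_coord_eq_self] at h₃
    exact h₃
end

section
/- Suppose the joint pmf p on X × Y is strictly positive and the encoder e is strictly positive (e(m|x) > 0 for all m, x). Then concept leakage is bounded below by the mutual information between the learned representation and the label: Λ(e) ≥ I(M;Y), where I(M;Y) is computed from the induced joint P(m,y) = ∑_x p(x,y)·e(m|x). (Lower bound of Proposition 4.2: zero leakage forces the machine concepts to carry no information about the label.) -/
open Finset

/-- The concept-leakage log-likelihood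
`L_CL(e,q) = ∑_{x,y} p(x,y) · log (∑_m q(y|m) · e(m|x))`. -/
noncomputable def LCL {X Y M : Type*} [Fintype X] [Fintype Y] [Fintype M]
    (p : X → Y → ℝ) (e : X → M → ℝ) (q : M → Y → ℝ) : ℝ :=
  ∑ x, ∑ y, p x y * Real.log (∑ m, q m y * e x m)

/-- The label marginal `p_Y(y) = ∑_x p(x,y)`. -/
noncomputable def pY {X Y : Type*} [Fintype X] (p : X → Y → ℝ) (y : Y) : ℝ :=
  ∑ x, p x y

/-- The induced representation–label joint pmf `P(m,y) = ∑_x p(x,y) · e(m|x)`. -/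
noncomputable def Pjoint {X Y M : Type*} [Fintype X]
    (p : X → Y → ℝ) (e : X → M → ℝ) (m : M) (y : Y) : ℝ :=
  ∑ x, p x y * e x m

/-- The representation marginal `P_M(m) = ∑_y P(m,y)`. -/
noncomputable def PM {X Y M : Type*} [Fintype X] [Fintype Y]
    (p : X → Y → ℝ) (e : X → M → ℝ) (m : M) : ℝ :=
  ∑ y, Pjoint p e m y

/-- Mutual information `I(M;Y)` of the induced joint. -/
noncomputable def MI {X Y M : Type*} [Fintype X] [Fintype Y] [Fintype M]
    (p : X → Y → ℝ) (e : X → M → ℝ) : ℝ :=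
  ∑ m, ∑ y, Pjoint p e m y * Real.log (Pjoint p e m y / (PM p e m * pY p y))

/-- Achievable concept-leakage log-likelihoods over strictly positive classifiers. -/
noncomputable def clSet {X Y M : Type*} [Fintype X] [Fintype Y] [Fintype M]
    (p : X → Y → ℝ) (e : X → M → ℝ) : Set ℝ :=
  {L : ℝ | ∃ q : M → Y → ℝ, (∀ m y, 0 < q m y) ∧ (∀ m, ∑ y, q m y = 1) ∧
    L = LCL p e q}

/-- Achievable uninformed log-likelihoods over strictly positive pmfs on `Y`. -/
noncomputable def unSet {X Y : Type*} [Fintype X] [Fintype Y]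
    (p : X → Y → ℝ) : Set ℝ :=
  {L : ℝ | ∃ r : Y → ℝ, (∀ y, 0 < r y) ∧ (∑ y, r y = 1) ∧
    L = ∑ y, pY p y * Real.log (r y)}

/-- Concept leakage `Λ(e)`. -/
noncomputable def Lam {X Y M : Type*} [Fintype X] [Fintype Y] [Fintype M]
    (p : X → Y → ℝ) (e : X → M → ℝ) : ℝ :=
  sSup (clSet p e) - sSup (unSet p)

theorem sum_mul_log_le_log_sum {ι : Type*} [Fintype ι] (w a : ι → ℝ) (hw : ∀ i, 0 ≤ w i)
    (hw_sum : ∑ i, w i = 1) (ha : ∀ i, 0 < a i) :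
    ∑ i, w i * Real.log (a i) ≤ Real.log (∑ i, a i * w i) := by
  have h := strictConcaveOn_log_Ioi.concaveOn.le_map_sum (t := Finset.univ) (w := w) (p := a)
    (fun i _ => hw i) hw_sum (fun i _ => ha i)
  simpa only [smul_eq_mul, mul_comm (a _)] using h

/-- Gibbs' inequality. -/
theorem sum_mul_log_le_sum_mul_log_self {ι : Type*} [Fintype ι] (a r : ι → ℝ)
    (ha : ∀ i, 0 < a i) (hr : ∀ i, 0 < r i) (hsum : ∑ i, r i ≤ ∑ i, a i) :
    ∑ i, a i * Real.log (r i) ≤ ∑ i, a i * Real.log (a i) := by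
  have h : ∀ i, a i * Real.log (r i) ≤ a i * Real.log (a i) + (r i - a i) := by
    intro i
    have h1 := mul_le_mul_of_nonneg_left
      (Real.log_le_sub_one_of_pos (div_pos (hr i) (ha i))) (ha i).le
    rw [Real.log_div (hr i).ne' (ha i).ne', mul_sub, mul_sub, mul_div_cancel₀ _ (ha i).ne'] at h1
    linarith
  have h2 := Finset.sum_le_sum fun i (_ : i ∈ Finset.univ) => h i
  rw [Finset.sum_add_distrib, Finset.sum_sub_distrib] at h2
  linarith

section Leakage

variable {X Y M : Type*} [Fintype X]

theorem pY_pos [Nonempty X] {p : X → Y → ℝ} (hp : ∀ x y, 0 < p x y) (y : Y) : 0 < pY p y :=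
  Finset.sum_pos (fun x _ => hp x y) Finset.univ_nonempty

theorem Pjoint_pos [Nonempty X] {p : X → Y → ℝ} (hp : ∀ x y, 0 < p x y) {e : X → M → ℝ}
    (he : ∀ x m, 0 < e x m) (m : M) (y : Y) : 0 < Pjoint p e m y :=
  Finset.sum_pos (fun x _ => mul_pos (hp x y) (he x m)) Finset.univ_nonempty

theorem PM_pos [Fintype Y] [Nonempty X] [Nonempty Y] {p : X → Y → ℝ}
    (hp : ∀ x y, 0 < p x y) {e : X → M → ℝ} (he : ∀ x m, 0 < e x m) (m : M) : 0 < PM p e m :=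
  Finset.sum_pos (fun y _ => Pjoint_pos hp he m y) Finset.univ_nonempty

theorem sum_Pjoint_eq_pY [Fintype M] (p : X → Y → ℝ) {e : X → M → ℝ}
    (he_sum : ∀ x, ∑ m, e x m = 1) (y : Y) : ∑ m, Pjoint p e m y = pY p y := by
  unfold Pjoint pY
  rw [Finset.sum_comm]
  simp [← Finset.mul_sum, he_sum]

theorem bddAbove_clSet [Fintype Y] [Fintype M] {p : X → Y → ℝ} (hp : ∀ x y, 0 < p x y)
    {e : X → M → ℝ} (he : ∀ x m, 0 < e x m) (he_sum : ∀ x, ∑ m, e x m = 1) :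
    BddAbove (clSet p e) := by
  refine ⟨0, ?_⟩
  rintro L ⟨q, hq, hq_sum, rfl⟩
  refine Finset.sum_nonpos fun x _ => Finset.sum_nonpos fun y _ =>
    mul_nonpos_of_nonneg_of_nonpos (hp x y).le (Real.log_nonpos
      (Finset.sum_nonneg fun m _ => (mul_pos (hq m y) (he x m)).le) ?_)
  rw [← he_sum x]
  refine Finset.sum_le_sum fun m _ => mul_le_of_le_one_left (he x m).le ?_
  rw [← hq_sum m]
  exact Finset.single_le_sum (f := q m) (fun y _ => (hq m y).le) (Finset.mem_univ y)

theorem sSup_unSet_le [Fintype Y] [Nonempty X] {p : X → Y → ℝ} (hp : ∀ x y, 0 < p x y)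
    (hp_sum : ∑ x, ∑ y, p x y = 1) : sSup (unSet p) ≤ ∑ y, pY p y * Real.log (pY p y) := by
  have hY : ∑ y, pY p y = 1 := by rw [← hp_sum, Finset.sum_comm]; rfl
  refine csSup_le ⟨_, pY p, pY_pos hp, hY, rfl⟩ ?_
  rintro L ⟨r, hr, hr_sum, rfl⟩
  exact sum_mul_log_le_sum_mul_log_self _ _ (pY_pos hp) hr (by rw [hr_sum, hY])

theorem sum_Pjoint_mul_log_le_LCL [Fintype Y] [Fintype M] {p : X → Y → ℝ} (hp : ∀ x y, 0 < p x y)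
    {e : X → M → ℝ} (he : ∀ x m, 0 < e x m) (he_sum : ∀ x, ∑ m, e x m = 1)
    {q : M → Y → ℝ} (hq : ∀ m y, 0 < q m y) :
    ∑ m, ∑ y, Pjoint p e m y * Real.log (q m y) ≤ LCL p e q := by
  calc ∑ m, ∑ y, Pjoint p e m y * Real.log (q m y)
      = ∑ x, ∑ y, p x y * ∑ m, e x m * Real.log (q m y) := by
        simp only [Pjoint, Finset.sum_mul, Finset.mul_sum, mul_assoc]
        rw [Finset.sum_comm, Finset.sum_comm (s := (Finset.univ : Finset X))]
        refine Finset.sum_congr rfl fun y _ => ?_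
        rw [Finset.sum_comm]
    _ ≤ LCL p e q := Finset.sum_le_sum fun x _ => Finset.sum_le_sum fun y _ =>
        mul_le_mul_of_nonneg_left (sum_mul_log_le_log_sum _ _ (fun m => (he x m).le) (he_sum x)
          fun m => hq m y) (hp x y).le

theorem MI_eq_sub [Fintype Y] [Fintype M] [Nonempty X] [Nonempty Y] {p : X → Y → ℝ}
    (hp : ∀ x y, 0 < p x y) {e : X → M → ℝ} (he : ∀ x m, 0 < e x m) (he_sum : ∀ x, ∑ m, e x m = 1) :
    MI p e = ∑ m, ∑ y, Pjoint p e m y * Real.log (Pjoint p e m y / PM p e m)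
      - ∑ y, pY p y * Real.log (pY p y) := by
  have h : ∑ y, pY p y * Real.log (pY p y) = ∑ m, ∑ y, Pjoint p e m y * Real.log (pY p y) := by
    rw [Finset.sum_comm]
    simp only [← Finset.sum_mul, sum_Pjoint_eq_pY p he_sum]
  rw [h, MI]
  simp only [← Finset.sum_sub_distrib, ← mul_sub, ← div_div]
  refine Finset.sum_congr rfl fun m _ => Finset.sum_congr rfl fun y _ => ?_
  rw [Real.log_div (div_pos (Pjoint_pos hp he m y) (PM_pos hp he m)).ne' (pY_pos hp y).ne']

end Leakage

/-- lower bound of Proposition 4.2.  If the joint pmf `p` and the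
encoder `e` are strictly positive, then concept leakage is bounded below by the mutual
information between the learned representation and the label: `Λ(e) ≥ I(M;Y)`. -/
theorem leakage_ge_mutual_information
    {X Y M : Type*} [Fintype X] [Fintype Y] [Fintype M]
    [Nonempty X] [Nonempty Y] [Nonempty M]
    (p : X → Y → ℝ) (hp_pos : ∀ x y, 0 < p x y) (hp_sum : ∑ x, ∑ y, p x y = 1)
    (e : X → M → ℝ) (he_pos : ∀ x m, 0 < e x m) (he_sum : ∀ x, ∑ m, e x m = 1) :
    MI p e ≤ Lam p e := by
  have hq : ∀ m y, 0 < Pjoint p e m y / PM p e m := fun m y =>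
    div_pos (Pjoint_pos hp_pos he_pos m y) (PM_pos hp_pos he_pos m)
  have hq_sum : ∀ m, ∑ y, Pjoint p e m y / PM p e m = 1 := fun m => by
    rw [← Finset.sum_div]
    exact div_self (PM_pos hp_pos he_pos m).ne'
  rw [MI_eq_sub hp_pos he_pos he_sum, Lam]
  refine sub_le_sub ?_ (sSup_unSet_le hp_pos hp_sum)
  exact (sum_Pjoint_mul_log_le_LCL hp_pos he_pos he_sum hq).trans
    (le_csSup (bddAbove_clSet hp_pos he_pos he_sum) ⟨_, hq, hq_sum, rfl⟩)
end

section
/- Assume the generative factorization p(x,y) = ∑_{gI,g₋} μ(gI)·ν(g₋)·c(y|g₋)·d(x|gI,g₋). Then for every encoder e and every strictly positive classifier q, L_CL(e,q) ≤ −H(Y) + I(G₋;Y). Consequently, if p_Y is strictly positive, concept leakage is bounded above by the mutual information between the label-relevant factors and the label: Λ(e) ≤ I(G₋;Y). (Upper bound of Proposition 4.2.) -/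
open Finset

/-- Mutual information `I(G₋;Y)` between the label-relevant generative factors and the
label, computed from the joint `ν(g₋)·c(y|g₋)`. -/
noncomputable def IGY {X Y Gm : Type*} [Fintype X] [Fintype Gm]
    (p : X → Y → ℝ) (ν : Gm → ℝ) (c : Gm → Y → ℝ) [Fintype Y] : ℝ :=
  ∑ gm, ∑ y, ν gm * c gm y * Real.log (c gm y / pY p y)

/-- Gibbs' inequality, for a strictly positive second argument of total mass at most one. -/
lemma sum_mul_log_le_sum_mul_log {Y : Type*} [Fintype Y] (a b : Y → ℝ)
    (ha : ∀ y, 0 ≤ a y) (hb : ∀ y, 0 < b y) (ha_sum : ∑ y, a y = 1) (hb_sum : ∑ y, b y ≤ 1) :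
    ∑ y, a y * Real.log (b y) ≤ ∑ y, a y * Real.log (a y) := by
  have key : ∀ y, a y * Real.log (b y) ≤ a y * Real.log (a y) + (b y - a y) := by
    intro y
    rcases (ha y).eq_or_lt with h | h
    · simpa [← h] using (hb y).le
    · have h1 := Real.log_le_sub_one_of_pos (div_pos (hb y) h)
      rw [Real.log_div (hb y).ne' h.ne'] at h1
      have h2 := mul_le_mul_of_nonneg_left h1 h.le
      have h3 : a y * (b y / a y - 1) = b y - a y := by field_simp
      rw [h3] at h2
      linarith
  have h := Finset.sum_le_sum fun y (_ : y ∈ Finset.univ) => key y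
  rw [Finset.sum_add_distrib, Finset.sum_sub_distrib] at h
  linarith

/-- If `p_Y` is the mixture of the `c(·|g)` with weights `ν`, then `−H(Y) + I(G;Y)` is minus the
conditional entropy of the label given `g`. -/
lemma sum_pY_mul_log_add_IGY {X Y Gm : Type*} [Fintype X] [Fintype Y] [Fintype Gm]
    (p : X → Y → ℝ) (ν : Gm → ℝ) (hν : ∀ g, 0 ≤ ν g) (c : Gm → Y → ℝ) (hc : ∀ g y, 0 ≤ c g y)
    (hpY : ∀ y, pY p y = ∑ g, ν g * c g y) :
    ∑ y, pY p y * Real.log (pY p y) + IGY p ν c =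
      ∑ g, ν g * ∑ y, c g y * Real.log (c g y) := by
  have h1 : ∑ y, pY p y * Real.log (pY p y) =
      ∑ g, ∑ y, ν g * c g y * Real.log (pY p y) := by
    rw [Finset.sum_comm]
    refine Finset.sum_congr rfl fun y _ => ?_
    rw [← Finset.sum_mul, ← hpY]
  rw [h1, IGY, ← Finset.sum_add_distrib]
  refine Finset.sum_congr rfl fun g _ => ?_
  rw [← Finset.sum_add_distrib, Finset.mul_sum]
  refine Finset.sum_congr rfl fun y _ => ?_
  rcases (mul_nonneg (hν g) (hc g y)).eq_or_lt with h | h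
  · rw [← mul_assoc, ← h]
    simp
  · have hle : ν g * c g y ≤ pY p y := by
      rw [hpY]
      exact Finset.single_le_sum (f := fun g => ν g * c g y)
        (fun i _ => mul_nonneg (hν i) (hc i y)) (Finset.mem_univ g)
    rw [Real.log_div (right_ne_zero_of_mul h.ne') (h.trans_le hle).ne']
    ring

/-- If `p(x,y) = ∑_g ν(g)·c(y|g)·D(x|g)`, then the concept-leakage log-likelihood is at most minus
the conditional entropy of the label given `g`. -/
lemma LCL_le_sum_mul_log {X Y M Gm : Type*} [Fintype X] [Fintype Y] [Fintype M] [Fintype Gm]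
    (p : X → Y → ℝ)
    (e : X → M → ℝ) (he : ∀ x m, 0 ≤ e x m) (he_sum : ∀ x, ∑ m, e x m = 1)
    (ν : Gm → ℝ) (hν : ∀ g, 0 ≤ ν g)
    (c : Gm → Y → ℝ) (hc : ∀ g y, 0 ≤ c g y) (hc_sum : ∀ g, ∑ y, c g y = 1)
    (D : Gm → X → ℝ) (hD : ∀ g x, 0 ≤ D g x) (hD_sum : ∀ g, ∑ x, D g x = 1)
    (hp : ∀ x y, p x y = ∑ g, ν g * c g y * D g x)
    (q : M → Y → ℝ) (hq : ∀ m y, 0 < q m y) (hq_sum : ∀ m, ∑ y, q m y = 1) :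
    LCL p e q ≤ ∑ g, ν g * ∑ y, c g y * Real.log (c g y) := by
  have hs_pos : ∀ x y, 0 < ∑ m, q m y * e x m := by
    intro x y
    obtain ⟨m, -, hm⟩ : ∃ m ∈ Finset.univ, 0 < e x m := by
      by_contra! h
      linarith [he_sum x, Finset.sum_nonpos h]
    exact Finset.sum_pos' (fun m _ => mul_nonneg (hq m y).le (he x m))
      ⟨m, Finset.mem_univ m, mul_pos (hq m y) hm⟩
  have hs_sum : ∀ x, ∑ y, ∑ m, q m y * e x m = 1 := by
    intro x
    rw [Finset.sum_comm]
    simp_rw [← Finset.sum_mul, hq_sum, one_mul, he_sum]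
  have hL : LCL p e q =
      ∑ g, ν g * ∑ x, D g x * ∑ y, c g y * Real.log (∑ m, q m y * e x m) := by
    calc LCL p e q
        = ∑ x, ∑ g, ∑ y, ν g * c g y * D g x * Real.log (∑ m, q m y * e x m) := by
          refine Finset.sum_congr rfl fun x _ => ?_
          rw [Finset.sum_comm]
          exact Finset.sum_congr rfl fun y _ => by rw [hp, Finset.sum_mul]
      _ = ∑ g, ∑ x, ∑ y, ν g * c g y * D g x * Real.log (∑ m, q m y * e x m) :=
          Finset.sum_comm
      _ = _ := by
          refine Finset.sum_congr rfl fun g _ => ?_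
          rw [Finset.mul_sum]
          refine Finset.sum_congr rfl fun x _ => ?_
          rw [Finset.mul_sum, Finset.mul_sum]
          exact Finset.sum_congr rfl fun y _ => by ring
  rw [hL]
  refine Finset.sum_le_sum fun g _ => mul_le_mul_of_nonneg_left ?_ (hν g)
  calc ∑ x, D g x * ∑ y, c g y * Real.log (∑ m, q m y * e x m)
      ≤ ∑ x, D g x * ∑ y, c g y * Real.log (c g y) :=
        Finset.sum_le_sum fun x _ => mul_le_mul_of_nonneg_left
          (sum_mul_log_le_sum_mul_log _ _ (hc g) (hs_pos x) (hc_sum g) (hs_sum x).le) (hD g x)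
    _ = ∑ y, c g y * Real.log (c g y) := by rw [← Finset.sum_mul, hD_sum, one_mul]

/-- upper bound of Proposition 4.2.  Under the generative
factorization `p(x,y) = ∑_{gI,g₋} μ(gI)·ν(g₋)·c(y|g₋)·d(x|gI,g₋)`, every strictly
positive classifier satisfies `L_CL(e,q) ≤ −H(Y) + I(G₋;Y)`; consequently, if `p_Y` is
strictly positive, concept leakage is bounded above by `I(G₋;Y)`. -/
theorem leakage_le_mutual_information
    {X Y M GI Gm : Type*} [Fintype X] [Fintype Y] [Fintype M] [Fintype GI] [Fintype Gm]
    [Nonempty X] [Nonempty Y] [Nonempty M] [Nonempty GI] [Nonempty Gm]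
    (p : X → Y → ℝ) (hp_nonneg : ∀ x y, 0 ≤ p x y) (hp_sum : ∑ x, ∑ y, p x y = 1)
    (e : X → M → ℝ) (he_nonneg : ∀ x m, 0 ≤ e x m) (he_sum : ∀ x, ∑ m, e x m = 1)
    (μ : GI → ℝ) (hμ_nonneg : ∀ gI, 0 ≤ μ gI) (hμ_sum : ∑ gI, μ gI = 1)
    (ν : Gm → ℝ) (hν_nonneg : ∀ gm, 0 ≤ ν gm) (hν_sum : ∑ gm, ν gm = 1)
    (c : Gm → Y → ℝ) (hc_nonneg : ∀ gm y, 0 ≤ c gm y) (hc_sum : ∀ gm, ∑ y, c gm y = 1)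
    (d : GI → Gm → X → ℝ) (hd_nonneg : ∀ gI gm x, 0 ≤ d gI gm x)
    (hd_sum : ∀ gI gm, ∑ x, d gI gm x = 1)
    (hfact : ∀ x y, p x y = ∑ gI, ∑ gm, μ gI * ν gm * c gm y * d gI gm x) :
    (∀ q : M → Y → ℝ, (∀ m y, 0 < q m y) → (∀ m, ∑ y, q m y = 1) →
      LCL p e q ≤ -(-(∑ y, pY p y * Real.log (pY p y))) + IGY p ν c) ∧
    ((∀ y, 0 < pY p y) → Lam p e ≤ IGY p ν c) := by
  let D : Gm → X → ℝ := fun g x => ∑ gI, μ gI * d gI g x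
  have hD : ∀ g x, 0 ≤ D g x := fun g x =>
    Finset.sum_nonneg fun gI _ => mul_nonneg (hμ_nonneg gI) (hd_nonneg gI g x)
  have hD_sum : ∀ g, ∑ x, D g x = 1 := by
    intro g
    simp only [D]
    rw [Finset.sum_comm]
    simp_rw [← Finset.mul_sum, hd_sum, mul_one, hμ_sum]
  have hp : ∀ x y, p x y = ∑ g, ν g * c g y * D g x := by
    intro x y
    rw [hfact, Finset.sum_comm]
    refine Finset.sum_congr rfl fun g _ => ?_
    rw [Finset.mul_sum]
    exact Finset.sum_congr rfl fun gI _ => by ring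
  have hpY : ∀ y, pY p y = ∑ g, ν g * c g y := by
    intro y
    simp only [pY, hp]
    rw [Finset.sum_comm]
    simp_rw [← Finset.mul_sum, hD_sum, mul_one]
  have hpY_sum : ∑ y, pY p y = 1 := by
    rw [← hp_sum, Finset.sum_comm]
    rfl
  have hpY_nonneg : ∀ y, 0 ≤ pY p y := fun y => Finset.sum_nonneg fun x _ => hp_nonneg x y
  have hbound : ∀ q : M → Y → ℝ, (∀ m y, 0 < q m y) → (∀ m, ∑ y, q m y = 1) →
      LCL p e q ≤ ∑ y, pY p y * Real.log (pY p y) + IGY p ν c := by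
    intro q hq hq_sum
    rw [sum_pY_mul_log_add_IGY p ν hν_nonneg c hc_nonneg hpY]
    exact LCL_le_sum_mul_log p e he_nonneg he_sum ν hν_nonneg c hc_nonneg hc_sum D hD hD_sum hp
      q hq hq_sum
  refine ⟨fun q hq hq_sum => by rw [neg_neg]; exact hbound q hq hq_sum, fun hpos => ?_⟩
  have hcl : sSup (clSet p e) ≤ ∑ y, pY p y * Real.log (pY p y) + IGY p ν c := by
    refine csSup_le ⟨_, fun _ => pY p, fun _ => hpos, fun _ => hpY_sum, rfl⟩ ?_
    rintro L ⟨q, hq, hq_sum, rfl⟩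
    exact hbound q hq hq_sum
  have hun : ∑ y, pY p y * Real.log (pY p y) ≤ sSup (unSet p) := by
    refine le_csSup ⟨∑ y, pY p y * Real.log (pY p y), ?_⟩ ⟨pY p, hpos, hpY_sum, rfl⟩
    rintro L ⟨r, hr, hr_sum, rfl⟩
    exact sum_mul_log_le_sum_mul_log _ _ hpY_nonneg hr hpY_sum hr_sum.le
  rw [Lam]
  linarith
end

section
/- Assume the generative factorization p(x,y) = ∑_{gI,g₋} μ(gI)·ν(g₋)·c(y|g₋)·d(x|gI,g₋) and that the encoder e satisfies content-style separation. Then the induced representation–label joint factorizes into its marginals: P(m,y) = P_M(m)·p_Y(y) for all m and y (i.e., the representation is independent of the label), and consequently the mutual information of the induced joint vanishes: I(M;Y) = 0. -/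
open Finset

/-- Averaging `f` over the inputs under a generative factorization splits into a
label-irrelevant and a label-relevant factor when the conditional average of `f` does not
depend on the label-relevant generative factor. -/
theorem sum_generative_mul_eq
    {X Y GI Gm : Type*} [Fintype X] [Fintype GI] [Fintype Gm]
    {p : X → Y → ℝ} {μ : GI → ℝ} {ν : Gm → ℝ} {c : Gm → Y → ℝ} {d : GI → Gm → X → ℝ}
    (hfact : ∀ x y, p x y = ∑ gI, ∑ gm, μ gI * ν gm * c gm y * d gI gm x)
    {f : X → ℝ} {k : GI → ℝ} (hk : ∀ gI gm, ∑ x, d gI gm x * f x = k gI) (y : Y) :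
    ∑ x, p x y * f x = (∑ gI, μ gI * k gI) * ∑ gm, ν gm * c gm y := by
  simp_rw [hfact, Finset.sum_mul]
  rw [Finset.sum_comm]
  refine Finset.sum_congr rfl fun gI _ => ?_
  rw [Finset.sum_comm, Finset.mul_sum]
  refine Finset.sum_congr rfl fun gm _ => ?_
  simp_rw [mul_assoc _ (d gI gm _), ← Finset.mul_sum, hk]
  ring

/-- Mutual information vanishes when the induced joint is the product of its marginals. -/
theorem MI_eq_zero_of_factorizes
    {X Y M : Type*} [Fintype X] [Fintype Y] [Fintype M] {p : X → Y → ℝ} {e : X → M → ℝ}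
    (h : ∀ m y, Pjoint p e m y = PM p e m * pY p y) : MI p e = 0 := by
  refine Finset.sum_eq_zero fun m _ => Finset.sum_eq_zero fun y _ => ?_
  rw [← h m y]
  by_cases h0 : Pjoint p e m y = 0
  · simp [h0]
  · simp [div_self h0]

/-- Under the generative factorization
`p(x,y) = ∑_{gI,g₋} μ(gI)·ν(g₋)·c(y|g₋)·d(x|gI,g₋)`, if the encoder satisfies
content-style separation (the induced representation kernel
`ẽ(m|gI,g₋) = ∑_x d(x|gI,g₋)·e(m|x)` does not depend on `g₋`), then the induced
representation–label joint factorizes into its marginals, `P(m,y) = P_M(m)·p_Y(y)`, and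
the mutual information of the induced joint vanishes: `I(M;Y) = 0`. -/
theorem content_style_separation_indep
    {X Y M GI Gm : Type*} [Fintype X] [Fintype Y] [Fintype M] [Fintype GI] [Fintype Gm]
    [Nonempty X] [Nonempty Y] [Nonempty M] [Nonempty GI] [Nonempty Gm]
    (p : X → Y → ℝ) (hp_nonneg : ∀ x y, 0 ≤ p x y) (hp_sum : ∑ x, ∑ y, p x y = 1)
    (e : X → M → ℝ) (he_nonneg : ∀ x m, 0 ≤ e x m) (he_sum : ∀ x, ∑ m, e x m = 1)
    (μ : GI → ℝ) (hμ_nonneg : ∀ gI, 0 ≤ μ gI) (hμ_sum : ∑ gI, μ gI = 1)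
    (ν : Gm → ℝ) (hν_nonneg : ∀ gm, 0 ≤ ν gm) (hν_sum : ∑ gm, ν gm = 1)
    (c : Gm → Y → ℝ) (hc_nonneg : ∀ gm y, 0 ≤ c gm y) (hc_sum : ∀ gm, ∑ y, c gm y = 1)
    (d : GI → Gm → X → ℝ) (hd_nonneg : ∀ gI gm x, 0 ≤ d gI gm x)
    (hd_sum : ∀ gI gm, ∑ x, d gI gm x = 1)
    (hfact : ∀ x y, p x y = ∑ gI, ∑ gm, μ gI * ν gm * c gm y * d gI gm x)
    (hsep : ∀ (m : M) (gI : GI) (gm gm' : Gm),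
      (∑ x, d gI gm x * e x m) = ∑ x, d gI gm' x * e x m) :
    (∀ m y, Pjoint p e m y = PM p e m * pY p y) ∧ MI p e = 0 := by
  obtain ⟨g₀⟩ := ‹Nonempty Gm›
  have hjoint : ∀ m y, Pjoint p e m y =
      (∑ gI, μ gI * ∑ x, d gI g₀ x * e x m) * ∑ gm, ν gm * c gm y := fun m y =>
    sum_generative_mul_eq hfact (fun gI gm => hsep m gI gm g₀) y
  have hlabel : ∀ y, pY p y = ∑ gm, ν gm * c gm y := fun y => by
    simpa [pY, hμ_sum] using
      sum_generative_mul_eq hfact (f := fun _ => 1) (k := fun _ => 1)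
        (by simpa using hd_sum) y
  have htotal : ∑ y, ∑ gm, ν gm * c gm y = 1 := by
    rw [Finset.sum_comm]
    simp [← Finset.mul_sum, hc_sum, hν_sum]
  have hmarginal : ∀ m, PM p e m = ∑ gI, μ gI * ∑ x, d gI g₀ x * e x m := fun m => by
    simp_rw [PM, hjoint, ← Finset.mul_sum]
    rw [htotal, mul_one]
  have hindep : ∀ m y, Pjoint p e m y = PM p e m * pY p y := fun m y => by
    rw [hjoint, hmarginal, hlabel]
  exact ⟨hindep, MI_eq_zero_of_factorizes hindep⟩
end

section
/- Assume the generative factorization p(x,y) = ∑_{gI,g₋} μ(gI)·ν(g₋)·c(y|g₋)·d(x|gI,g₋), that the encoder e satisfies content-style separation, and that p_Y is strictly positive. Then for every strictly positive classifier q, the concept-leakage log-likelihood is bounded by the entropy of the label: L_CL(e,q) ≤ −H(Y). -/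
open Finset

section ContentStyle

variable {X Y GI Gm : Type*} [Fintype X] [Fintype GI] [Fintype Gm]

/-- Integrating a function of the input against a factorized joint mass function. -/
lemma sum_factorized_mul {p : X → Y → ℝ} {μ : GI → ℝ} {ν : Gm → ℝ} {c : Gm → Y → ℝ}
    {d : GI → Gm → X → ℝ}
    (hfact : ∀ x y, p x y = ∑ gI, ∑ gm, μ gI * ν gm * c gm y * d gI gm x)
    (f : X → ℝ) (y : Y) :
    ∑ x, p x y * f x = ∑ gI, ∑ gm, μ gI * ν gm * c gm y * ∑ x, d gI gm x * f x := by
  simp_rw [hfact, sum_mul, mul_sum, mul_assoc]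
  rw [sum_comm]
  exact sum_congr rfl fun gI _ => sum_comm

/-- If the conditional mean of `f` given the generative factors does not depend on the
label-relevant one, then `f` is uncorrelated with the label. -/
lemma sum_factorized_mul_of_separated {p : X → Y → ℝ} {μ : GI → ℝ} {ν : Gm → ℝ}
    {c : Gm → Y → ℝ} {d : GI → Gm → X → ℝ} (hμ_sum : ∑ gI, μ gI = 1)
    (hd_sum : ∀ gI gm, ∑ x, d gI gm x = 1)
    (hfact : ∀ x y, p x y = ∑ gI, ∑ gm, μ gI * ν gm * c gm y * d gI gm x)
    {f : X → ℝ} {k : GI → ℝ} (hf : ∀ gI gm, ∑ x, d gI gm x * f x = k gI) (y : Y) :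
    ∑ x, p x y * f x = pY p y * ∑ gI, μ gI * k gI := by
  have hpY : pY p y = ∑ gm, ν gm * c gm y := by
    have h := sum_factorized_mul hfact (fun _ => 1) y
    simp only [mul_one, hd_sum, mul_assoc, ← mul_sum] at h
    rw [pY, h, ← sum_mul, hμ_sum, one_mul]
  rw [sum_factorized_mul hfact, hpY, sum_mul_sum, sum_comm]
  refine sum_congr rfl fun gm _ => sum_congr rfl fun gI _ => ?_
  rw [hf]
  ring

end ContentStyle

/-- The tangent-line bound for the logarithm at `b`. -/
lemma Real.log_le_log_add_div_sub_one {a b : ℝ} (ha : 0 < a) (hb : 0 < b) :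
    Real.log a ≤ Real.log b + (a / b - 1) := by
  have h := Real.log_le_sub_one_of_pos (div_pos ha hb)
  rw [Real.log_div ha.ne' hb.ne'] at h
  linarith

/-- Under the generative factorization
`p(x,y) = ∑_{gI,g₋} μ(gI)·ν(g₋)·c(y|g₋)·d(x|gI,g₋)`, if the encoder satisfies
content-style separation and `p_Y` is strictly positive, then for every strictly
positive classifier `q` the concept-leakage log-likelihood is bounded by the entropy of
the label: `L_CL(e,q) ≤ −H(Y)` where `H(Y) = −∑_y p_Y(y)·log p_Y(y)`. -/
theorem content_style_separation_LCL_le_neg_entropy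
    {X Y M GI Gm : Type*} [Fintype X] [Fintype Y] [Fintype M] [Fintype GI] [Fintype Gm]
    [Nonempty X] [Nonempty Y] [Nonempty M] [Nonempty GI] [Nonempty Gm]
    (p : X → Y → ℝ) (hp_nonneg : ∀ x y, 0 ≤ p x y) (hp_sum : ∑ x, ∑ y, p x y = 1)
    (e : X → M → ℝ) (he_nonneg : ∀ x m, 0 ≤ e x m) (he_sum : ∀ x, ∑ m, e x m = 1)
    (μ : GI → ℝ) (hμ_nonneg : ∀ gI, 0 ≤ μ gI) (hμ_sum : ∑ gI, μ gI = 1)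
    (ν : Gm → ℝ) (hν_nonneg : ∀ gm, 0 ≤ ν gm) (hν_sum : ∑ gm, ν gm = 1)
    (c : Gm → Y → ℝ) (hc_nonneg : ∀ gm y, 0 ≤ c gm y) (hc_sum : ∀ gm, ∑ y, c gm y = 1)
    (d : GI → Gm → X → ℝ) (hd_nonneg : ∀ gI gm x, 0 ≤ d gI gm x)
    (hd_sum : ∀ gI gm, ∑ x, d gI gm x = 1)
    (hfact : ∀ x y, p x y = ∑ gI, ∑ gm, μ gI * ν gm * c gm y * d gI gm x)
    (hsep : ∀ (m : M) (gI : GI) (gm gm' : Gm),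
      (∑ x, d gI gm x * e x m) = ∑ x, d gI gm' x * e x m)
    (hpY_pos : ∀ y, 0 < pY p y)
    (q : M → Y → ℝ) (hq_pos : ∀ m y, 0 < q m y) (hq_sum : ∀ m, ∑ y, q m y = 1) :
    LCL p e q ≤ -(-(∑ y, pY p y * Real.log (pY p y))) := by
  obtain ⟨g₀⟩ := ‹Nonempty Gm›
  set k : M → ℝ := fun m => ∑ gI, μ gI * ∑ x, d gI g₀ x * e x m with hk
  have hk_sum : ∑ m, k m = 1 := by
    have h : ∀ gI, ∑ m, ∑ x, d gI g₀ x * e x m = 1 := fun gI => by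
      rw [sum_comm]
      simp_rw [← mul_sum, he_sum, mul_one, hd_sum]
    simp only [hk]
    rw [sum_comm]
    simp_rw [← mul_sum, h, mul_one, hμ_sum]
  have hpe : ∀ y m, ∑ x, p x y * e x m = pY p y * k m := fun y m =>
    sum_factorized_mul_of_separated hμ_sum hd_sum hfact (fun gI gm => hsep m gI gm g₀) y
  have hL_pos : ∀ x y, 0 < ∑ m, q m y * e x m := fun x y => by
    obtain ⟨m, -, hm⟩ : ∃ m ∈ univ, 0 < e x m :=
      exists_lt_of_sum_lt (f := fun _ => 0) (by simp [he_sum])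
    exact sum_pos' (fun m _ => mul_nonneg (hq_pos m y).le (he_nonneg x m))
      ⟨m, mem_univ m, mul_pos (hq_pos m y) hm⟩
  have hL_sum : ∀ y, ∑ x, p x y * ∑ m, q m y * e x m = pY p y * ∑ m, q m y * k m := fun y => by
    simp_rw [mul_sum, mul_left_comm _ (q _ y)]
    rw [sum_comm]
    simp_rw [← mul_sum, hpe]
  have hqk : ∑ y, ∑ m, q m y * k m = 1 := by
    rw [sum_comm]
    simp_rw [← sum_mul, hq_sum, one_mul, hk_sum]
  have hpY_sum : ∑ y, pY p y = 1 := by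
    simp only [pY]
    rw [sum_comm, hp_sum]
  have key : ∀ y, ∑ x, p x y * Real.log (∑ m, q m y * e x m) ≤
      pY p y * Real.log (pY p y) + (∑ m, q m y * k m - pY p y) := fun y => by
    calc ∑ x, p x y * Real.log (∑ m, q m y * e x m)
        ≤ ∑ x, p x y * (Real.log (pY p y) + ((∑ m, q m y * e x m) / pY p y - 1)) :=
          sum_le_sum fun x _ => mul_le_mul_of_nonneg_left
            (Real.log_le_log_add_div_sub_one (hL_pos x y) (hpY_pos y)) (hp_nonneg x y)
      _ = pY p y * Real.log (pY p y) +
            ((∑ x, p x y * ∑ m, q m y * e x m) / pY p y - pY p y) := by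
          simp_rw [mul_add, mul_sub, mul_one, sum_add_distrib, sum_sub_distrib, ← mul_div_assoc,
            ← sum_div, ← sum_mul]
          rfl
      _ = _ := by rw [hL_sum, mul_div_cancel_left₀ _ (hpY_pos y).ne']
  calc LCL p e q = ∑ y, ∑ x, p x y * Real.log (∑ m, q m y * e x m) := sum_comm
    _ ≤ ∑ y, (pY p y * Real.log (pY p y) + (∑ m, q m y * k m - pY p y)) :=
        sum_le_sum fun y _ => key y
    _ = -(-(∑ y, pY p y * Real.log (pY p y))) := by
        rw [sum_add_distrib, sum_sub_distrib, hqk, hpY_sum, sub_self, add_zero, neg_neg]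
end

section
/- (Proposition 4.3.) Assume the generative factorization p(x,y) = ∑_{gI,g₋} μ(gI)·ν(g₋)·c(y|g₋)·d(x|gI,g₋), that the encoder e satisfies content-style separation, and that p_Y is strictly positive. Then concept leakage vanishes: Λ(e) = 0. -/
open Finset

/-- A weighted average of positive reals, with weights forming a pmf, is positive. -/
theorem sum_mul_pos_of_pmf {ι : Type*} [Fintype ι] (w f : ι → ℝ) (hw : ∀ i, 0 ≤ w i)
    (hw1 : ∑ i, w i = 1) (hf : ∀ i, 0 < f i) : 0 < ∑ i, w i * f i := by
  simpa using (convex_Ioi (0 : ℝ)).sum_mem (t := univ) (w := w) (z := f)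
    (fun i _ => hw i) hw1 (fun i _ => hf i)

/-- Jensen's inequality for the logarithm, with weights of total mass `∑ i, w i > 0` and
weighted average `a`. -/
theorem sum_mul_log_le {ι : Type*} [Fintype ι] (w f : ι → ℝ) (a : ℝ) (hw : ∀ i, 0 ≤ w i)
    (hw0 : 0 < ∑ i, w i) (hf : ∀ i, 0 < f i) (ha : ∑ i, w i * f i = (∑ i, w i) * a) :
    ∑ i, w i * Real.log (f i) ≤ (∑ i, w i) * Real.log a := by
  have h := strictConcaveOn_log_Ioi.concaveOn.le_map_centerMass (t := univ) (w := w) (p := f)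
    (fun i _ => hw i) hw0 (fun i _ => hf i)
  simp only [Finset.centerMass, smul_eq_mul, Function.comp_apply, ha,
    inv_mul_cancel_left₀ hw0.ne'] at h
  rwa [inv_mul_le_iff₀ hw0] at h

theorem sum_pY {X Y : Type*} [Fintype X] [Fintype Y] (p : X → Y → ℝ) :
    ∑ y, pY p y = ∑ x, ∑ y, p x y :=
  Finset.sum_comm

/-- Under strictly positive pmfs the uninformed log-likelihood is nonpositive. -/
theorem bddAbove_unSet {X Y : Type*} [Fintype X] [Fintype Y] (p : X → Y → ℝ)
    (hp : ∀ y, 0 ≤ pY p y) : BddAbove (unSet p) := by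
  refine ⟨0, ?_⟩
  rintro L ⟨r, hr, hr1, rfl⟩
  refine Finset.sum_nonpos fun y _ => mul_nonpos_of_nonneg_of_nonpos (hp y) ?_
  refine Real.log_nonpos (hr y).le (hr1 ▸ ?_)
  exact Finset.single_le_sum (fun z _ => (hr z).le) (mem_univ y)

/-- Constant classifiers achieve every uninformed log-likelihood. -/
theorem unSet_subset_clSet {X Y M : Type*} [Fintype X] [Fintype Y] [Fintype M]
    (p : X → Y → ℝ) (e : X → M → ℝ) (he : ∀ x, ∑ m, e x m = 1) : unSet p ⊆ clSet p e := by
  rintro L ⟨r, hr, hr1, rfl⟩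
  refine ⟨fun _ => r, fun _ => hr, fun _ => hr1, ?_⟩
  simp only [LCL, pY, ← Finset.mul_sum, he, mul_one, Finset.sum_mul]
  exact Finset.sum_comm

/-- If the representation is distributed as `P` independently of the label, then every
classifier is dominated by an uninformed pmf, namely its average under `P`. -/
theorem exists_unSet_ge_of_indep {X Y M : Type*} [Fintype X] [Fintype Y] [Fintype M]
    (p : X → Y → ℝ) (hp : ∀ x y, 0 ≤ p x y) (hpY : ∀ y, 0 < pY p y)
    (e : X → M → ℝ) (he : ∀ x m, 0 ≤ e x m) (he1 : ∀ x, ∑ m, e x m = 1)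
    (P : M → ℝ) (hP : ∀ m, 0 ≤ P m) (hP1 : ∑ m, P m = 1)
    (hind : ∀ y m, ∑ x, p x y * e x m = pY p y * P m) {L : ℝ} (hL : L ∈ clSet p e) :
    ∃ U ∈ unSet p, L ≤ U := by
  obtain ⟨q, hq, hq1, rfl⟩ := hL
  refine ⟨_, ⟨fun y => ∑ m, P m * q m y, fun y => ?_, ?_, rfl⟩, ?_⟩
  · exact sum_mul_pos_of_pmf P (q · y) hP hP1 (hq · y)
  · rw [Finset.sum_comm]
    simp only [← Finset.mul_sum, hq1, mul_one, hP1]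
  · rw [LCL, Finset.sum_comm]
    refine Finset.sum_le_sum fun y _ => ?_
    refine sum_mul_log_le (p · y) (fun x => ∑ m, q m y * e x m) _ (hp · y) (hpY y)
      (fun x => ?_) ?_
    · simpa only [mul_comm] using sum_mul_pos_of_pmf (e x) (q · y) (he x) (he1 x) (hq · y)
    · calc ∑ x, p x y * ∑ m, q m y * e x m
          = ∑ m, (∑ x, p x y * e x m) * q m y := by
            simp only [Finset.mul_sum, Finset.sum_mul]
            rw [Finset.sum_comm]
            exact Finset.sum_congr rfl fun m _ => Finset.sum_congr rfl fun x _ => by ring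
        _ = (∑ x, p x y) * ∑ m, P m * q m y := by
            simp only [hind, Finset.mul_sum, pY, mul_assoc]

/-- Integrating a test function `f` on inputs against the factorized joint pmf, when its
conditional mean `F gI` given the generative factors depends on the irrelevant one only. -/
theorem sum_factorization_mul {X Y GI Gm : Type*} [Fintype X] [Fintype GI] [Fintype Gm]
    (p : X → Y → ℝ) (μ : GI → ℝ) (ν : Gm → ℝ) (c : Gm → Y → ℝ) (d : GI → Gm → X → ℝ)
    (hfact : ∀ x y, p x y = ∑ gI, ∑ gm, μ gI * ν gm * c gm y * d gI gm x)
    (f : X → ℝ) (F : GI → ℝ) (hF : ∀ gI gm, ∑ x, d gI gm x * f x = F gI) (y : Y) :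
    ∑ x, p x y * f x = (∑ gm, ν gm * c gm y) * ∑ gI, μ gI * F gI := by
  calc ∑ x, p x y * f x
      = ∑ gI, ∑ gm, μ gI * ν gm * c gm y * ∑ x, d gI gm x * f x := by
        simp only [hfact, Finset.sum_mul, Finset.mul_sum]
        rw [Finset.sum_comm]
        refine Finset.sum_congr rfl fun gI _ => ?_
        rw [Finset.sum_comm]
        simp only [mul_assoc]
    _ = (∑ gm, ν gm * c gm y) * ∑ gI, μ gI * F gI := by
        simp only [hF, Finset.sum_mul, Finset.mul_sum]
        exact Finset.sum_congr rfl fun _ _ => Finset.sum_congr rfl fun _ _ => by ring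

/-- Proposition 4.3.  Under the generative factorization
`p(x,y) = ∑_{gI,g₋} μ(gI)·ν(g₋)·c(y|g₋)·d(x|gI,g₋)`, if the encoder satisfies
content-style separation and `p_Y` is strictly positive, then concept leakage
vanishes: `Λ(e) = 0`. -/
theorem content_style_separation_zero_leakage
    {X Y M GI Gm : Type*} [Fintype X] [Fintype Y] [Fintype M] [Fintype GI] [Fintype Gm]
    [Nonempty X] [Nonempty Y] [Nonempty M] [Nonempty GI] [Nonempty Gm]
    (p : X → Y → ℝ) (hp_nonneg : ∀ x y, 0 ≤ p x y) (hp_sum : ∑ x, ∑ y, p x y = 1)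
    (e : X → M → ℝ) (he_nonneg : ∀ x m, 0 ≤ e x m) (he_sum : ∀ x, ∑ m, e x m = 1)
    (μ : GI → ℝ) (hμ_nonneg : ∀ gI, 0 ≤ μ gI) (hμ_sum : ∑ gI, μ gI = 1)
    (ν : Gm → ℝ) (hν_nonneg : ∀ gm, 0 ≤ ν gm) (hν_sum : ∑ gm, ν gm = 1)
    (c : Gm → Y → ℝ) (hc_nonneg : ∀ gm y, 0 ≤ c gm y) (hc_sum : ∀ gm, ∑ y, c gm y = 1)
    (d : GI → Gm → X → ℝ) (hd_nonneg : ∀ gI gm x, 0 ≤ d gI gm x)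
    (hd_sum : ∀ gI gm, ∑ x, d gI gm x = 1)
    (hfact : ∀ x y, p x y = ∑ gI, ∑ gm, μ gI * ν gm * c gm y * d gI gm x)
    (hsep : ∀ (m : M) (gI : GI) (gm gm' : Gm),
      (∑ x, d gI gm x * e x m) = ∑ x, d gI gm' x * e x m)
    (hpY_pos : ∀ y, 0 < pY p y) :
    Lam p e = 0 := by
  have g₀ : Gm := Classical.arbitrary Gm
  have hpYc (y : Y) : pY p y = ∑ gm, ν gm * c gm y := by
    simpa [pY, hμ_sum] using
      sum_factorization_mul p μ ν c d hfact (fun _ => 1) (fun _ => 1) (by simp [hd_sum]) y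
  let P : M → ℝ := fun m => ∑ gI, μ gI * ∑ x, d gI g₀ x * e x m
  have hP (m : M) : 0 ≤ P m :=
    Finset.sum_nonneg fun gI _ => mul_nonneg (hμ_nonneg gI) <|
      Finset.sum_nonneg fun x _ => mul_nonneg (hd_nonneg gI g₀ x) (he_nonneg x m)
  have hind (y : Y) (m : M) : ∑ x, p x y * e x m = pY p y * P m := by
    rw [hpYc]
    exact sum_factorization_mul p μ ν c d hfact (e · m) _ (fun gI gm => hsep m gI gm g₀) y
  have hP1 : ∑ m, P m = 1 := by
    simp only [P]
    rw [Finset.sum_comm]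
    simp only [← Finset.mul_sum]
    rw [← hμ_sum]
    refine Finset.sum_congr rfl fun gI _ => ?_
    rw [Finset.sum_comm]
    simp only [← Finset.mul_sum, he_sum, mul_one, hd_sum]
  have hbdd : BddAbove (unSet p) := bddAbove_unSet p fun y => (hpY_pos y).le
  have hsub : unSet p ⊆ clSet p e := unSet_subset_clSet p e he_sum
  have hne : (unSet p).Nonempty := ⟨_, pY p, hpY_pos, (sum_pY p).trans hp_sum, rfl⟩
  have hle : ∀ L ∈ clSet p e, L ≤ sSup (unSet p) := fun L hL => by
    obtain ⟨U, hU, hLU⟩ := exists_unSet_ge_of_indep p hp_nonneg hpY_pos e he_nonneg he_sum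
      P hP hP1 hind hL
    exact hLU.trans (le_csSup hbdd hU)
  exact sub_eq_zero.mpr <| le_antisymm (csSup_le (hne.mono hsub) hle)
    (csSup_le_csSup ⟨_, hle⟩ hne hsub)
end

section
/- (Corollary 4.4.) In the three-factor generative setup, suppose the encoder's induced representation kernel depends only on the non-discriminative interpretable factor g_r, i.e., ∑_x d(x|g_r,g_k,g₋)·e(m|x) = ẽ(m|g_r) for all m, g_r, g_k, g₋. Then the induced representation–label joint factorizes, P(m,y) = P_M(m)·p_Y(y) for all m, y, and, if p_Y is strictly positive, the concept leakage of this encoder vanishes: Λ(e) = 0. (Machine representations aligned only to concepts that are not discriminative for the label suffer no concept leakage.) -/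
open Finset

/-- In the three-factor setup, the `p(·, y)`-average of a function of the input whose conditional
mean depends only on `g_r` is the product of its overall mean and the label probability. -/
theorem sum_threeFactor_mul {X Y Gr Gk Gm : Type*}
    [Fintype X] [Fintype Gr] [Fintype Gk] [Fintype Gm]
    {μr : Gr → ℝ} {μk : Gk → ℝ} {ν : Gm → ℝ} {c : Gk → Gm → Y → ℝ} {d : Gr → Gk → Gm → X → ℝ}
    {p : X → Y → ℝ}
    (hfact : ∀ x y, p x y =
      ∑ gr, ∑ gk, ∑ gm, μr gr * μk gk * ν gm * c gk gm y * d gr gk gm x)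
    {f : X → ℝ} {s : Gr → ℝ} (hf : ∀ gr gk gm, ∑ x, d gr gk gm x * f x = s gr) (y : Y) :
    ∑ x, p x y * f x = (∑ gr, μr gr * s gr) * ∑ gk, ∑ gm, μk gk * ν gm * c gk gm y := by
  simp only [hfact, Finset.sum_mul]
  rw [Finset.sum_comm]
  refine Finset.sum_congr rfl fun gr _ => ?_
  rw [Finset.sum_comm, Finset.mul_sum]
  refine Finset.sum_congr rfl fun gk _ => ?_
  rw [Finset.sum_comm, Finset.mul_sum]
  refine Finset.sum_congr rfl fun gm _ => ?_
  rw [← hf gr gk gm, Finset.mul_sum, Finset.sum_mul]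
  exact Finset.sum_congr rfl fun x _ => by ring

theorem sum_sum_mul_eq_sum_pY_mul {X Y : Type*} [Fintype X] [Fintype Y]
    (p : X → Y → ℝ) (f : Y → ℝ) : ∑ x, ∑ y, p x y * f y = ∑ y, pY p y * f y := by
  rw [Finset.sum_comm]
  simp only [pY, Finset.sum_mul]

/-- For a classifier that ignores the representation, the concept-leakage log-likelihood is the
uninformed log-likelihood. -/
theorem LCL_const {X Y M : Type*} [Fintype X] [Fintype Y] [Fintype M]
    (p : X → Y → ℝ) {e : X → M → ℝ} (he_sum : ∀ x, ∑ m, e x m = 1) (r : Y → ℝ) :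
    LCL p e (fun _ => r) = ∑ y, pY p y * Real.log (r y) := by
  simp only [LCL, ← Finset.mul_sum, he_sum, mul_one]
  exact sum_sum_mul_eq_sum_pY_mul p fun y => Real.log (r y)

theorem sum_PM {X Y M : Type*} [Fintype X] [Fintype Y] [Fintype M]
    (p : X → Y → ℝ) {e : X → M → ℝ} (he_sum : ∀ x, ∑ m, e x m = 1) :
    ∑ m, PM p e m = ∑ y, pY p y := by
  simp only [PM, Pjoint, pY]
  rw [Finset.sum_comm]
  refine Finset.sum_congr rfl fun y _ => ?_
  rw [Finset.sum_comm]
  simp only [← Finset.mul_sum, he_sum, mul_one]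

/-- If representation and label are independent, no classifier has a larger concept-leakage
log-likelihood than the negative label entropy. -/
theorem LCL_le_of_indep {X Y M : Type*} [Fintype X] [Fintype Y] [Fintype M]
    {p : X → Y → ℝ} (hp : ∀ x y, 0 ≤ p x y) (hp_sum : ∑ y, pY p y = 1)
    (hpos : ∀ y, 0 < pY p y)
    {e : X → M → ℝ} (he_nonneg : ∀ x m, 0 ≤ e x m) (he_sum : ∀ x, ∑ m, e x m = 1)
    (hindep : ∀ m y, Pjoint p e m y = PM p e m * pY p y)
    {q : M → Y → ℝ} (hq : ∀ m y, 0 < q m y) (hq_sum : ∀ m, ∑ y, q m y = 1) :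
    LCL p e q ≤ ∑ y, pY p y * Real.log (pY p y) := by
  have hmix (x : X) (y : Y) : 0 < ∑ m, q m y * e x m := by
    obtain ⟨m, -, hm⟩ : ∃ m ∈ Finset.univ, 0 < e x m := by
      refine Finset.exists_lt_of_sum_lt (f := fun _ => (0 : ℝ)) ?_
      simp [he_sum]
    exact Finset.sum_pos' (fun m _ => mul_nonneg (hq m y).le (he_nonneg x m))
      ⟨m, Finset.mem_univ m, mul_pos (hq m y) hm⟩
  have hratio : ∑ x, ∑ y, p x y * ((∑ m, q m y * e x m) / pY p y) = 1 :=
    calc ∑ x, ∑ y, p x y * ((∑ m, q m y * e x m) / pY p y)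
        = ∑ y, ∑ m, q m y * Pjoint p e m y / pY p y := by
          rw [Finset.sum_comm]
          refine Finset.sum_congr rfl fun y _ => ?_
          simp only [Pjoint, Finset.mul_sum, Finset.sum_div]
          rw [Finset.sum_comm]
          exact Finset.sum_congr rfl fun m _ => Finset.sum_congr rfl fun x _ => by ring
      _ = ∑ y, ∑ m, q m y * PM p e m := by
          refine Finset.sum_congr rfl fun y _ => Finset.sum_congr rfl fun m _ => ?_
          rw [hindep, ← mul_assoc, mul_div_cancel_right₀ _ (hpos y).ne']
      _ = 1 := by
          rw [Finset.sum_comm]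
          simp only [← Finset.sum_mul, hq_sum, one_mul, sum_PM p he_sum, hp_sum]
  have hmass : ∑ x, ∑ y, p x y = 1 := by
    rw [Finset.sum_comm]
    exact hp_sum
  rw [← sum_sum_mul_eq_sum_pY_mul p fun y => Real.log (pY p y), ← sub_nonpos]
  calc LCL p e q - ∑ x, ∑ y, p x y * Real.log (pY p y)
      = ∑ x, ∑ y, p x y * Real.log ((∑ m, q m y * e x m) / pY p y) := by
        simp only [LCL, ← Finset.sum_sub_distrib, ← mul_sub,
          Real.log_div (hmix _ _).ne' (hpos _).ne']
    _ ≤ ∑ x, ∑ y, p x y * ((∑ m, q m y * e x m) / pY p y - 1) := by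
        gcongr with x _ y _
        · exact hp x y
        · exact Real.log_le_sub_one_of_pos (div_pos (hmix x y) (hpos y))
    _ = 0 := by
        simp only [mul_sub, mul_one, Finset.sum_sub_distrib, hratio, hmass, sub_self]

/-- If representation and label are independent, concept leakage vanishes. -/
theorem Lam_eq_zero_of_indep {X Y M : Type*} [Fintype X] [Fintype Y] [Fintype M]
    {p : X → Y → ℝ} (hp : ∀ x y, 0 ≤ p x y) (hp_sum : ∑ y, pY p y = 1)
    (hpos : ∀ y, 0 < pY p y)
    {e : X → M → ℝ} (he_nonneg : ∀ x m, 0 ≤ e x m) (he_sum : ∀ x, ∑ m, e x m = 1)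
    (hindep : ∀ m y, Pjoint p e m y = PM p e m * pY p y) :
    Lam p e = 0 := by
  have hbound {q : M → Y → ℝ} (hq : ∀ m y, 0 < q m y) (hq_sum : ∀ m, ∑ y, q m y = 1) :=
    LCL_le_of_indep hp hp_sum hpos he_nonneg he_sum hindep hq hq_sum
  have hcl : IsGreatest (clSet p e) (∑ y, pY p y * Real.log (pY p y)) := by
    refine ⟨⟨fun _ => pY p, fun _ => hpos, fun _ => hp_sum, (LCL_const p he_sum _).symm⟩, ?_⟩
    rintro _ ⟨q, hq, hq_sum, rfl⟩
    exact hbound hq hq_sum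
  have hun : IsGreatest (unSet p) (∑ y, pY p y * Real.log (pY p y)) := by
    refine ⟨⟨pY p, hpos, hp_sum, rfl⟩, ?_⟩
    rintro _ ⟨r, hr, hr_sum, rfl⟩
    rw [← LCL_const p he_sum r]
    exact hbound (fun _ => hr) fun _ => hr_sum
  rw [Lam, hcl.csSup_eq, hun.csSup_eq, sub_self]

/-- Corollary 4.4.  In the three-factor generative setup, if the
encoder's induced representation kernel depends only on the non-discriminative
interpretable factor `g_r`, i.e. `∑_x d(x|g_r,g_k,g₋)·e(m|x) = ẽ(m|g_r)` for all
`m, g_r, g_k, g₋`, then the induced representation–label joint factorizes,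
`P(m,y) = P_M(m)·p_Y(y)`, and if `p_Y` is strictly positive, concept leakage vanishes:
`Λ(e) = 0`. -/
theorem aligned_to_nondiscriminative_zero_leakage
    {X Y M Gr Gk Gm : Type*}
    [Fintype X] [Fintype Y] [Fintype M] [Fintype Gr] [Fintype Gk] [Fintype Gm]
    [Nonempty X] [Nonempty Y] [Nonempty M] [Nonempty Gr] [Nonempty Gk] [Nonempty Gm]
    (μr : Gr → ℝ) (hμr_nonneg : ∀ gr, 0 ≤ μr gr) (hμr_sum : ∑ gr, μr gr = 1)
    (μk : Gk → ℝ) (hμk_nonneg : ∀ gk, 0 ≤ μk gk) (hμk_sum : ∑ gk, μk gk = 1)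
    (ν : Gm → ℝ) (hν_nonneg : ∀ gm, 0 ≤ ν gm) (hν_sum : ∑ gm, ν gm = 1)
    (c : Gk → Gm → Y → ℝ) (hc_nonneg : ∀ gk gm y, 0 ≤ c gk gm y)
    (hc_sum : ∀ gk gm, ∑ y, c gk gm y = 1)
    (d : Gr → Gk → Gm → X → ℝ) (hd_nonneg : ∀ gr gk gm x, 0 ≤ d gr gk gm x)
    (hd_sum : ∀ gr gk gm, ∑ x, d gr gk gm x = 1)
    (p : X → Y → ℝ)
    (hfact : ∀ x y, p x y =
      ∑ gr, ∑ gk, ∑ gm, μr gr * μk gk * ν gm * c gk gm y * d gr gk gm x)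
    (e : X → M → ℝ) (he_nonneg : ∀ x m, 0 ≤ e x m) (he_sum : ∀ x, ∑ m, e x m = 1)
    (etil : Gr → M → ℝ)
    (hker : ∀ (m : M) (gr : Gr) (gk : Gk) (gm : Gm),
      (∑ x, d gr gk gm x * e x m) = etil gr m) :
    (∀ m y, Pjoint p e m y = PM p e m * pY p y) ∧
    ((∀ y, 0 < pY p y) → Lam p e = 0) := by
  have hp (x : X) (y : Y) : 0 ≤ p x y := by
    rw [hfact]
    exact Finset.sum_nonneg fun gr _ => Finset.sum_nonneg fun gk _ => Finset.sum_nonneg fun gm _ =>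
      mul_nonneg (mul_nonneg (mul_nonneg (mul_nonneg (hμr_nonneg gr) (hμk_nonneg gk))
        (hν_nonneg gm)) (hc_nonneg gk gm y)) (hd_nonneg gr gk gm x)
  have hpY (y : Y) : pY p y = ∑ gk, ∑ gm, μk gk * ν gm * c gk gm y := by
    simpa [pY, hμr_sum] using
      sum_threeFactor_mul hfact (f := fun _ => 1) (s := fun _ => 1) (by simpa using hd_sum) y
  have hp_sum : ∑ y, pY p y = 1 := by
    simp only [hpY]
    rw [Finset.sum_comm]
    simp_rw [Finset.sum_comm (s := (Finset.univ : Finset Y)), ← Finset.mul_sum, hc_sum, mul_one,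
      ← Finset.mul_sum, hν_sum, mul_one, hμk_sum]
  have hjoint (m : M) (y : Y) : Pjoint p e m y = (∑ gr, μr gr * etil gr m) * pY p y := by
    rw [hpY]
    exact sum_threeFactor_mul hfact (hker m) y
  have hindep (m : M) (y : Y) : Pjoint p e m y = PM p e m * pY p y := by
    simp only [PM, hjoint, ← Finset.mul_sum, hp_sum, mul_one]
  exact ⟨hindep, fun hpos => Lam_eq_zero_of_indep hp hp_sum hpos he_nonneg he_sum hindep⟩
end
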